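/- arXiv:2111.06758 — 2 statements merged into one kernel-verified Lean document; each statement's English description precedes it below -/
import Mathlib

section
/- Let $E$ be a Banach lattice and $M$ a positive uniformly bounded subset of $E$ such that $M$ is totally bounded with respect to the norm $p_M$. Then $(E_M, p_M)$ is an AM-space with order unit if and only if there exists a positive vector $u \in E_M$ such that $E_M$ equals the principal ideal $E_u = \{v \in E : |v| \le t u \text{ for some } t \ge 0\}$ and $p_M(v) = \frac{1}{p_M(u)} \|v\|_u$ for every $v \in E_M$, where $\|v\|_u = \inf\{t > 0 : |v| \le t u\}$. -/
open scoped BigOperators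

section MajorizedDefs

variable {E : Type*} [AddCommGroup E] [PartialOrder E] [Module ℝ E]

/-- `M` is a *positive subset* of the ordered vector space `E`: it is nonempty, contained in
the positive cone, and `0` does not belong to its convex hull. -/
def IsPositiveSubset (M : Set E) : Prop :=
  M.Nonempty ∧ (∀ m ∈ M, 0 ≤ m) ∧ (0 : E) ∉ convexHull ℝ M

/-- The proper convex cone `C_M` generated by a positive subset `M`. -/
def coneGen (M : Set E) : Set E :=
  {c | ∃ (t : ℝ) (m : E), 0 ≤ t ∧ m ∈ convexHull ℝ M ∧ m ≠ 0 ∧ c = t • m}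

/-- The majorized space `E_M`: all vectors `v` with `±v ≤ c` for some `c ∈ C_M`. -/
def EMaj (M : Set E) : Set E :=
  {v | ∃ c ∈ coneGen M, -v ≤ c ∧ v ≤ c}

/-- The majorizing seminorm `p_M`. -/
noncomputable def pM (M : Set E) (v : E) : ℝ :=
  sInf {s : ℝ | ∃ (n : ℕ) (t : Fin n → ℝ) (m : Fin n → E),
    0 < n ∧ (∀ j, 0 ≤ t j) ∧ (∀ j, m j ∈ M) ∧
    (-v ≤ ∑ j, t j • m j) ∧ (v ≤ ∑ j, t j • m j) ∧ s = ∑ j, t j}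

end MajorizedDefs

section OrderedModule

variable {E : Type*} [AddCommGroup E] [Module ℝ E] {M : Set E}

/-- Every conic combination of points of `M` is a multiple of a convex combination. -/
lemma exists_mem_convexHull_sum_smul_eq {n : ℕ} {t : Fin n → ℝ} {m : Fin n → E} (hn : 0 < n)
    (ht : ∀ j, 0 ≤ t j) (hm : ∀ j, m j ∈ M) :
    ∃ c ∈ convexHull ℝ M, ∑ j, t j • m j = (∑ j, t j) • c := by
  rcases (Finset.sum_nonneg fun j _ => ht j).eq_or_lt' with h | h
  · refine ⟨m ⟨0, hn⟩, subset_convexHull ℝ M (hm _), ?_⟩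
    have h0 := (Finset.sum_eq_zero_iff_of_nonneg fun j _ => ht j).1 h
    rw [h, zero_smul]
    exact Finset.sum_eq_zero fun j hj => by rw [h0 j hj, zero_smul]
  · refine ⟨Finset.univ.centerMass t m,
      Finset.univ.centerMass_mem_convexHull (fun j _ => ht j) h fun j _ => hm j, ?_⟩
    rw [Finset.centerMass, smul_inv_smul₀ h.ne']

variable [Lattice E]

lemma pM_eq_sInf (v : E) :
    pM M v = sInf {s : ℝ | 0 ≤ s ∧ ∃ c ∈ convexHull ℝ M, |v| ≤ s • c} := by
  unfold pM
  congr 1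
  ext s
  constructor
  · rintro ⟨n, t, m, hn, ht, hm, h₁, h₂, rfl⟩
    obtain ⟨c, hc, hsum⟩ := exists_mem_convexHull_sum_smul_eq hn ht hm
    rw [hsum] at h₁ h₂
    exact ⟨Finset.sum_nonneg fun j _ => ht j, c, hc, abs_le'.2 ⟨h₂, h₁⟩⟩
  · rintro ⟨hs, c, hc, hv⟩
    obtain ⟨ι, _, w, z, hw₀, hw₁, hz, rfl⟩ := mem_convexHull_iff_exists_fintype.1 hc
    have hne : Nonempty ι := by
      by_contra h
      rw [not_nonempty_iff] at h
      simp at hw₁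
    let φ := (Fintype.equivFin ι).symm
    have hsum : ∑ j, (s * w (φ j)) • z (φ j) = s • ∑ i, w i • z i := by
      rw [φ.sum_comp fun i => (s * w i) • z i, Finset.smul_sum]
      simp only [mul_smul]
    refine ⟨Fintype.card ι, fun j => s * w (φ j), fun j => z (φ j), Fintype.card_pos,
      fun j => mul_nonneg hs (hw₀ _), fun j => hz _, ?_, ?_, ?_⟩
    · rw [hsum]; exact (abs_le'.1 hv).2
    · rw [hsum]; exact (abs_le'.1 hv).1
    · rw [φ.sum_comp fun i => s * w i, ← Finset.mul_sum, hw₁, mul_one]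

lemma IsPositiveSubset.mem_EMaj_iff (hM : IsPositiveSubset M) {v : E} :
    v ∈ EMaj M ↔ ∃ s : ℝ, 0 ≤ s ∧ ∃ c ∈ convexHull ℝ M, |v| ≤ s • c := by
  constructor
  · rintro ⟨_, ⟨s, c, hs, hc, -, rfl⟩, h₁, h₂⟩
    exact ⟨s, hs, c, hc, abs_le'.2 ⟨h₂, h₁⟩⟩
  · rintro ⟨s, hs, c, hc, h⟩
    exact ⟨s • c, ⟨s, c, hs, hc, fun h0 => hM.2.2 (h0 ▸ hc), rfl⟩, (abs_le'.1 h).2,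
      (abs_le'.1 h).1⟩

lemma pM_nonneg (v : E) : 0 ≤ pM M v := by
  rw [pM_eq_sInf]
  exact Real.sInf_nonneg fun s hs => hs.1

lemma pM_le {v c : E} {s : ℝ} (hs : 0 ≤ s) (hc : c ∈ convexHull ℝ M) (h : |v| ≤ s • c) :
    pM M v ≤ s := by
  rw [pM_eq_sInf]
  exact csInf_le ⟨0, fun _ hr => hr.1⟩ ⟨hs, c, hc, h⟩

lemma IsPositiveSubset.exists_lt_of_pM_lt (hM : IsPositiveSubset M) {v : E} (hv : v ∈ EMaj M)
    {r : ℝ} (h : pM M v < r) :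
    ∃ s : ℝ, 0 ≤ s ∧ s < r ∧ ∃ c ∈ convexHull ℝ M, |v| ≤ s • c := by
  rw [pM_eq_sInf] at h
  obtain ⟨s, hs, hsr⟩ := exists_lt_of_csInf_lt (hM.mem_EMaj_iff.1 hv) h
  exact ⟨s, hs.1, hsr, hs.2⟩

lemma IsPositiveSubset.mem_EMaj_of_abs_le (hM : IsPositiveSubset M) {v w : E}
    (hw : w ∈ EMaj M) (h : |v| ≤ |w|) : v ∈ EMaj M := by
  obtain ⟨s, hs, c, hc, hwc⟩ := hM.mem_EMaj_iff.1 hw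
  exact hM.mem_EMaj_iff.2 ⟨s, hs, c, hc, h.trans hwc⟩

lemma IsPositiveSubset.pM_mono (hM : IsPositiveSubset M) {v w : E}
    (hw : w ∈ EMaj M) (h : |v| ≤ |w|) : pM M v ≤ pM M w := by
  refine le_of_forall_gt_imp_ge_of_dense fun r hr => ?_
  obtain ⟨s, hs, hsr, c, hc, hwc⟩ := hM.exists_lt_of_pM_lt hw hr
  exact (pM_le hs hc (h.trans hwc)).trans hsr.le

variable [IsOrderedAddMonoid E]

lemma pM_abs (v : E) : pM M |v| = pM M v := by
  simp only [pM_eq_sInf, abs_abs]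

lemma pM_sub_comm (v w : E) : pM M (v - w) = pM M (w - v) := by
  rw [← pM_abs, abs_sub_comm, pM_abs]

lemma IsPositiveSubset.subset_EMaj (hM : IsPositiveSubset M) : M ⊆ EMaj M := fun m hm =>
  hM.mem_EMaj_iff.2 ⟨1, zero_le_one, m, subset_convexHull ℝ M hm, by
    rw [one_smul, abs_of_nonneg (hM.2.1 m hm)]⟩

lemma IsPositiveSubset.pM_le_one (hM : IsPositiveSubset M) {m : E} (hm : m ∈ M) :
    pM M m ≤ 1 :=
  pM_le zero_le_one (subset_convexHull ℝ M hm) (by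
    rw [one_smul, abs_of_nonneg (hM.2.1 m hm)])

lemma abs_add_le_smul_convexHull {v w c d : E} {s t : ℝ} (hs : 0 ≤ s) (ht : 0 ≤ t)
    (hc : c ∈ convexHull ℝ M) (hd : d ∈ convexHull ℝ M) (hv : |v| ≤ s • c) (hw : |w| ≤ t • d) :
    ∃ b ∈ convexHull ℝ M, |v + w| ≤ (s + t) • b := by
  have h : |v + w| ≤ s • c + t • d := (abs_add_le v w).trans (add_le_add hv hw)
  obtain ⟨b, hb, hbe⟩ := (convex_convexHull ℝ M).exists_mem_add_smul_eq hc hd hs ht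
  exact ⟨b, hb, hbe ▸ h⟩

lemma IsPositiveSubset.add_mem_EMaj (hM : IsPositiveSubset M) {v w : E}
    (hv : v ∈ EMaj M) (hw : w ∈ EMaj M) : v + w ∈ EMaj M := by
  obtain ⟨s, hs, c, hc, hvc⟩ := hM.mem_EMaj_iff.1 hv
  obtain ⟨t, ht, d, hd, hwd⟩ := hM.mem_EMaj_iff.1 hw
  exact hM.mem_EMaj_iff.2 ⟨s + t, add_nonneg hs ht,
    abs_add_le_smul_convexHull hs ht hc hd hvc hwd⟩

lemma IsPositiveSubset.sub_mem_EMaj (hM : IsPositiveSubset M) {v w : E}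
    (hv : v ∈ EMaj M) (hw : w ∈ EMaj M) : v - w ∈ EMaj M :=
  sub_eq_add_neg v w ▸ hM.add_mem_EMaj hv (hM.mem_EMaj_of_abs_le hw (abs_neg w).le)

lemma IsPositiveSubset.pM_add_le (hM : IsPositiveSubset M) {v w : E}
    (hv : v ∈ EMaj M) (hw : w ∈ EMaj M) : pM M (v + w) ≤ pM M v + pM M w := by
  refine le_of_forall_pos_le_add fun ε hε => ?_
  obtain ⟨s, hs, hsr, c, hc, hvc⟩ := hM.exists_lt_of_pM_lt hv (lt_add_of_pos_right _ (half_pos hε))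
  obtain ⟨t, ht, htr, d, hd, hwd⟩ := hM.exists_lt_of_pM_lt hw (lt_add_of_pos_right _ (half_pos hε))
  obtain ⟨b, hb, h⟩ := abs_add_le_smul_convexHull hs ht hc hd hvc hwd
  linarith [pM_le (add_nonneg hs ht) hb h]

lemma IsPositiveSubset.abs_mem_EMaj (hM : IsPositiveSubset M) {v : E} (hv : v ∈ EMaj M) :
    |v| ∈ EMaj M :=
  hM.mem_EMaj_of_abs_le hv (abs_abs v).le

lemma IsPositiveSubset.sup_mem_EMaj (hM : IsPositiveSubset M) {v w : E}
    (hv : v ∈ EMaj M) (hw : w ∈ EMaj M) (hv₀ : 0 ≤ v) (hw₀ : 0 ≤ w) : v ⊔ w ∈ EMaj M := by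
  refine hM.mem_EMaj_of_abs_le (hM.add_mem_EMaj hv hw) ?_
  rw [abs_of_nonneg (hv₀.trans le_sup_left), abs_of_nonneg (add_nonneg hv₀ hw₀)]
  exact sup_le (le_add_of_nonneg_right hw₀) (le_add_of_nonneg_left hv₀)

/-- A multiple of `u` dominating `v` bounds `p_M v` by that multiple of `p_M u`. -/
lemma IsPositiveSubset.pM_le_mul [PosSMulStrictMono ℝ E] (hM : IsPositiveSubset M) {u v : E} (hu : u ∈ EMaj M)
    (hu₀ : 0 ≤ u) {t : ℝ} (ht : 0 ≤ t) (h : |v| ≤ t • u) :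
    v ∈ EMaj M ∧ pM M v ≤ t * pM M u := by
  have key : ∀ {s : ℝ} {c : E}, |u| ≤ s • c → |v| ≤ (t * s) • c := fun {s c} hs => by
    rw [abs_of_nonneg hu₀] at hs
    rw [mul_smul]
    exact h.trans (smul_le_smul_of_nonneg_left hs ht)
  constructor
  · obtain ⟨s, hs, c, hc, hsc⟩ := hM.mem_EMaj_iff.1 hu
    exact hM.mem_EMaj_iff.2 ⟨t * s, mul_nonneg ht hs, c, hc, key hsc⟩
  · refine le_of_forall_pos_le_add fun ε hε => ?_
    have hpos : 0 < ε / (t + 1) := by positivity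
    obtain ⟨s, hs, hsr, c, hc, hsc⟩ := hM.exists_lt_of_pM_lt hu (lt_add_of_pos_right _ hpos)
    have h₁ : t * (ε / (t + 1)) ≤ ε := by
      rw [← mul_div_assoc, div_le_iff₀ (by positivity)]
      nlinarith
    have h₂ := mul_le_mul_of_nonneg_left hsr.le ht
    linarith [pM_le (mul_nonneg ht hs) hc (key hsc)]

/-- The points of a `p_M`-net of `M` may be taken in `M`. -/
lemma IsPositiveSubset.exists_finset_subset (hM : IsPositiveSubset M)
    (htb : ∀ ε : ℝ, 0 < ε → ∃ F : Finset E, ↑F ⊆ EMaj M ∧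
      ∀ m ∈ M, ∃ f ∈ F, pM M (m - f) < ε) {ε : ℝ} (hε : 0 < ε) :
    ∃ G : Finset E, G.Nonempty ∧ ↑G ⊆ M ∧ ∀ m ∈ M, ∃ g ∈ G, pM M (m - g) < ε := by
  classical
  obtain ⟨F, hF, hcov⟩ := htb (ε / 2) (half_pos hε)
  obtain ⟨m₀, hm₀⟩ := hM.1
  have hr : ∀ f : E, ∃ r ∈ M, (∃ m ∈ M, pM M (m - f) < ε / 2) → pM M (r - f) < ε / 2 := by
    intro f
    by_cases h : ∃ m ∈ M, pM M (m - f) < ε / 2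
    · obtain ⟨m, hm, hmf⟩ := h
      exact ⟨m, hm, fun _ => hmf⟩
    · exact ⟨m₀, hm₀, fun h' => absurd h' h⟩
  choose r hrM hr using hr
  obtain ⟨f₀, hf₀, -⟩ := hcov m₀ hm₀
  refine ⟨F.image r, ⟨r f₀, Finset.mem_image_of_mem r hf₀⟩, ?_, fun m hm => ?_⟩
  · intro g hg
    obtain ⟨f, -, rfl⟩ := Finset.mem_image.1 (Finset.mem_coe.1 hg)
    exact hrM f
  · obtain ⟨f, hf, hmf⟩ := hcov m hm
    refine ⟨r f, Finset.mem_image_of_mem r hf, ?_⟩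
    have h₁ := hr f ⟨m, hm, hmf⟩
    rw [pM_sub_comm] at h₁
    have h₂ := hM.pM_add_le (hM.sub_mem_EMaj (hM.subset_EMaj hm) (hF hf))
      (hM.sub_mem_EMaj (hF hf) (hM.subset_EMaj (hrM f)))
    rw [sub_add_sub_cancel] at h₂
    linarith

lemma IsPositiveSubset.pM_finset_sup'_le (hM : IsPositiveSubset M)
    (hAM : ∀ v ∈ EMaj M, ∀ w ∈ EMaj M, 0 ≤ v → 0 ≤ w →
      pM M (v ⊔ w) = max (pM M v) (pM M w))
    {ι : Type*} {G : Finset ι} (hG : G.Nonempty) {f : ι → E} {r : ℝ}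
    (hf : ∀ g ∈ G, f g ∈ EMaj M ∧ 0 ≤ f g ∧ pM M (f g) ≤ r) :
    G.sup' hG f ∈ EMaj M ∧ 0 ≤ G.sup' hG f ∧ pM M (G.sup' hG f) ≤ r :=
  Finset.sup'_induction hG f (p := fun x => x ∈ EMaj M ∧ 0 ≤ x ∧ pM M x ≤ r)
    (fun _ hv _ hw => ⟨hM.sup_mem_EMaj hv.1 hw.1 hv.2.1 hw.2.1, hv.2.1.trans le_sup_left,
      hAM _ hv.1 _ hw.1 hv.2.1 hw.2.1 ▸ max_le hv.2.2 hw.2.2⟩) hf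

/-- If `H` is an `r`-net of `G`, then `sup G` exceeds `sup H` by at most a vector of size `r`. -/
lemma IsPositiveSubset.exists_sup'_le_sup'_add (hM : IsPositiveSubset M)
    (hAM : ∀ v ∈ EMaj M, ∀ w ∈ EMaj M, 0 ≤ v → 0 ≤ w →
      pM M (v ⊔ w) = max (pM M v) (pM M w))
    {G H : Finset E} (hG : G.Nonempty) (hH : H.Nonempty) (hGM : ↑G ⊆ EMaj M)
    (hHM : ↑H ⊆ EMaj M) {r : ℝ} (hr : ∀ g ∈ G, ∃ h ∈ H, pM M (g - h) < r) :
    ∃ d ∈ EMaj M, 0 ≤ d ∧ pM M d ≤ r ∧ G.sup' hG id ≤ H.sup' hH id + d := by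
  have hr' : ∀ g : E, ∃ h : E, g ∈ G → h ∈ H ∧ pM M (g - h) < r := fun g => by
    by_cases hg : g ∈ G
    · obtain ⟨h, hh, hgh⟩ := hr g hg
      exact ⟨h, fun _ => ⟨hh, hgh⟩⟩
    · exact ⟨0, fun h => absurd h hg⟩
  choose k hk using hr'
  obtain ⟨h₁, h₂, h₃⟩ := hM.pM_finset_sup'_le hAM hG (f := fun g => |g - k g|) (r := r)
    fun g hg => ⟨hM.abs_mem_EMaj (hM.sub_mem_EMaj (hGM hg) (hHM (hk g hg).1)), abs_nonneg _,
      (pM_abs _).trans_le (hk g hg).2.le⟩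
  refine ⟨_, h₁, h₂, h₃, Finset.sup'_le hG _ fun g hg => ?_⟩
  calc g = k g + (g - k g) := by abel
    _ ≤ H.sup' hH id + G.sup' hG fun g => |g - k g| :=
      add_le_add (Finset.le_sup' id (hk g hg).1)
        ((le_abs_self _).trans (Finset.le_sup' (fun g => |g - k g|) hg))

end OrderedModule

section BanachLattice

variable {E : Type*} [NormedAddCommGroup E] [Lattice E] [HasSolidNorm E] [NormedSpace ℝ E]
  {M : Set E}

lemma IsPositiveSubset.norm_le_mul_pM (hM : IsPositiveSubset M) {C : ℝ}
    (hC : ∀ m ∈ M, ‖m‖ ≤ C) {v : E} (hv : v ∈ EMaj M) : ‖v‖ ≤ C * pM M v := by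
  obtain ⟨m₀, hm₀⟩ := hM.1
  have hC₀ : 0 ≤ C := (norm_nonneg m₀).trans (hC m₀ hm₀)
  have hhull : ∀ c ∈ convexHull ℝ M, ‖c‖ ≤ C := fun c hc => by
    have := convexHull_min (fun m hm => mem_closedBall_zero_iff.2 (hC m hm))
      (convex_closedBall (0 : E) C) hc
    exact mem_closedBall_zero_iff.1 this
  refine le_of_forall_pos_le_add fun ε hε => ?_
  have hpos : 0 < ε / (C + 1) := by positivity
  obtain ⟨s, hs, hsr, c, hc, hvc⟩ := hM.exists_lt_of_pM_lt hv (lt_add_of_pos_right _ hpos)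
  have h₁ : ‖v‖ ≤ ‖s • c‖ := norm_le_norm_of_abs_le_abs (hvc.trans (le_abs_self _))
  rw [norm_smul, Real.norm_of_nonneg hs] at h₁
  have h₂ : C * (ε / (C + 1)) ≤ ε := by
    rw [← mul_div_assoc, div_le_iff₀ (by positivity)]
    nlinarith
  nlinarith [mul_le_mul_of_nonneg_left (hhull c hc) hs, mul_le_mul_of_nonneg_left hsr.le hC₀]

lemma IsPositiveSubset.tendsto_zero_of_pM (hM : IsPositiveSubset M) {C : ℝ}
    (hC : ∀ m ∈ M, ‖m‖ ≤ C) {v : ℕ → E} (hv : ∀ n, v n ∈ EMaj M)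
    (h : Filter.Tendsto (fun n => pM M (v n)) Filter.atTop (nhds 0)) :
    Filter.Tendsto v Filter.atTop (nhds 0) :=
  squeeze_zero_norm (fun n => hM.norm_le_mul_pM hC (hv n)) (by simpa using h.const_mul C)

variable [IsOrderedAddMonoid E]

/-- A `p_M`-totally bounded `M` has an upper bound in the unit ball of a complete `E_M`
satisfying the AM-identity. -/
lemma IsPositiveSubset.exists_upperBound (hM : IsPositiveSubset M)
    (hbdd : ∃ C : ℝ, ∀ m ∈ M, ‖m‖ ≤ C)
    (htb : ∀ ε : ℝ, 0 < ε → ∃ F : Finset E, ↑F ⊆ EMaj M ∧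
      ∀ m ∈ M, ∃ f ∈ F, pM M (m - f) < ε)
    (hcomplete : ∀ x : ℕ → E, (∀ n, x n ∈ EMaj M) →
      (∀ ε : ℝ, 0 < ε → ∃ N : ℕ, ∀ p ≥ N, ∀ q ≥ N, pM M (x p - x q) < ε) →
      ∃ l ∈ EMaj M, ∀ ε : ℝ, 0 < ε → ∃ N : ℕ, ∀ n ≥ N, pM M (x n - l) < ε)
    (hAM : ∀ v ∈ EMaj M, ∀ w ∈ EMaj M, 0 ≤ v → 0 ≤ w →
      pM M (v ⊔ w) = max (pM M v) (pM M w)) :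
    ∃ u ∈ EMaj M, pM M u ≤ 1 ∧ ∀ m ∈ M, m ≤ u := by
  obtain ⟨C, hC⟩ := hbdd
  choose G hG hGM hcov using fun n : ℕ =>
    hM.exists_finset_subset htb (Nat.one_div_pos_of_nat (α := ℝ) (n := n))
  have hGE : ∀ n, ↑(G n) ⊆ EMaj M := fun n => (hGM n).trans hM.subset_EMaj
  let x : ℕ → E := fun n => (G n).sup' (hG n) id
  have hx : ∀ n, x n ∈ EMaj M ∧ 0 ≤ x n ∧ pM M (x n) ≤ 1 := fun n =>
    hM.pM_finset_sup'_le hAM (hG n) fun g hg =>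
      ⟨hGE n hg, hM.2.1 g (hGM n hg), hM.pM_le_one (hGM n hg)⟩
  have hle : ∀ N p q : ℕ, N ≤ q →
      ∃ d ∈ EMaj M, 0 ≤ d ∧ pM M d ≤ 1 / ((N : ℝ) + 1) ∧ x p - x q ≤ d := by
    intro N p q hq
    obtain ⟨d, hd, hd₀, hdr, hpq⟩ := hM.exists_sup'_le_sup'_add hAM (hG p) (hG q) (hGE p) (hGE q)
      fun g hg => hcov q g (hGM p hg)
    exact ⟨d, hd, hd₀, hdr.trans (Nat.one_div_le_one_div hq), sub_le_iff_le_add'.2 hpq⟩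
  obtain ⟨u, hu, hlim⟩ := hcomplete x (fun n => (hx n).1) fun ε hε => by
    obtain ⟨N, hN⟩ := exists_nat_one_div_lt hε
    refine ⟨N, fun p hp q hq => ?_⟩
    obtain ⟨d, hd, hd₀, hdr, hpq⟩ := hle N p q hq
    obtain ⟨d', hd', hd₀', hdr', hqp⟩ := hle N q p hp
    calc pM M (x p - x q) ≤ pM M (d ⊔ d') := by
          refine hM.pM_mono (hM.sup_mem_EMaj hd hd' hd₀ hd₀') ?_
          rw [abs_of_nonneg (hd₀.trans le_sup_left)]
          exact abs_le'.2 ⟨hpq.trans le_sup_left, by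
            rw [neg_sub]; exact hqp.trans le_sup_right⟩
      _ = max (pM M d) (pM M d') := hAM d hd d' hd' hd₀ hd₀'
      _ ≤ 1 / ((N : ℝ) + 1) := max_le hdr hdr'
      _ < ε := hN
  refine ⟨u, hu, le_of_forall_pos_le_add fun ε hε => ?_, fun m hm => ?_⟩
  · obtain ⟨N, hN⟩ := hlim ε hε
    have h₁ := hM.pM_add_le (hM.sub_mem_EMaj hu (hx N).1) (hx N).1
    rw [sub_add_cancel, pM_sub_comm] at h₁
    linarith [hN N le_rfl, (hx N).2.2]
  · choose g hg hmg using fun n => hcov n m hm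
    have hxu : Filter.Tendsto (fun n => x n - u) Filter.atTop (nhds 0) := by
      refine hM.tendsto_zero_of_pM hC (fun n => hM.sub_mem_EMaj (hx n).1 hu) ?_
      refine Metric.tendsto_atTop.2 fun ε hε => ?_
      obtain ⟨N, hN⟩ := hlim ε hε
      exact ⟨N, fun n hn => by
        rw [Real.dist_0_eq_abs, abs_of_nonneg (pM_nonneg _)]; exact hN n hn⟩
    have hmg' : Filter.Tendsto (fun n => m - g n) Filter.atTop (nhds 0) :=
      hM.tendsto_zero_of_pM hC
        (fun n => hM.sub_mem_EMaj (hM.subset_EMaj hm) (hGE n (hg n)))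
        (squeeze_zero (fun n => pM_nonneg _) (fun n => (hmg n).le)
          tendsto_one_div_add_atTop_nhds_zero_nat)
    have hsum := (hmg'.add hxu).add_const u
    rw [add_zero, zero_add] at hsum
    refine ge_of_tendsto' hsum fun n => ?_
    have := Finset.le_sup' id (hg n)
    calc m = (m - g n) + (g n - u) + u := by abel
      _ ≤ (m - g n) + (x n - u) + u := by gcongr; exact this

end BanachLattice

/-- Let `E` be a Banach lattice and `M` a positive uniformly bounded subset of
`E` which is totally bounded for the `p_M`-norm. Then `(E_M, p_M)` is an AM-space with order
unit (i.e. it is complete, satisfies the AM-identity on positive vectors, and has an order unit)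
if and only if there is a positive `u ∈ E_M` with `E_M = E_u` and `p_M = (1 / p_M u) ‖·‖_u`. -/
theorem AMspace_iff_principal_ideal
    {E : Type*} [NormedAddCommGroup E] [Lattice E] [HasSolidNorm E] [IsOrderedAddMonoid E]
    [NormedSpace ℝ E] [PosSMulStrictMono ℝ E] [PosSMulReflectLT ℝ E]
    [CompleteSpace E]
    (M : Set E) (hM : IsPositiveSubset M)
    (hbdd : ∃ C : ℝ, ∀ m ∈ M, ‖m‖ ≤ C)
    (htb : ∀ ε : ℝ, 0 < ε → ∃ F : Finset E, ↑F ⊆ EMaj M ∧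
      ∀ m ∈ M, ∃ f ∈ F, pM M (m - f) < ε) :
    ((∀ x : ℕ → E, (∀ n, x n ∈ EMaj M) →
        (∀ ε : ℝ, 0 < ε → ∃ N : ℕ, ∀ p ≥ N, ∀ q ≥ N, pM M (x p - x q) < ε) →
        ∃ l ∈ EMaj M, ∀ ε : ℝ, 0 < ε → ∃ N : ℕ, ∀ n ≥ N, pM M (x n - l) < ε) ∧
      (∀ v ∈ EMaj M, ∀ w ∈ EMaj M, 0 ≤ v → 0 ≤ w →
        pM M (v ⊔ w) = max (pM M v) (pM M w)) ∧
      (∃ e ∈ EMaj M, 0 ≤ e ∧ ∀ v ∈ EMaj M, ∃ t : ℝ, 0 < t ∧ v ≤ t • e)) ↔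
    (∃ u : E, 0 ≤ u ∧ u ∈ EMaj M ∧
      EMaj M = {v : E | ∃ t : ℝ, 0 ≤ t ∧ |v| ≤ t • u} ∧
      ∀ v ∈ EMaj M, pM M v = (1 / pM M u) * sInf {t : ℝ | 0 < t ∧ |v| ≤ t • u}) := by
  obtain ⟨m₀, hm₀⟩ := hM.1
  have hm₀ne : m₀ ≠ 0 := fun h => hM.2.2 (h ▸ subset_convexHull ℝ M hm₀)
  constructor
  · rintro ⟨hcomplete, hAM, -⟩
    obtain ⟨u, hu, hu₁, hub⟩ := hM.exists_upperBound hbdd htb hcomplete hAM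
    have hu₀ : 0 ≤ u := (hM.2.1 m₀ hm₀).trans (hub m₀ hm₀)
    have hhull : ∀ c ∈ convexHull ℝ M, c ≤ u := fun c hc =>
      convexHull_min hub (convex_Iic u) hc
    have hdom : ∀ {v c : E} {s : ℝ}, 0 ≤ s → c ∈ convexHull ℝ M → |v| ≤ s • c → |v| ≤ s • u :=
      fun hs hc h => h.trans (smul_le_smul_of_nonneg_left (hhull _ hc) hs)
    have hpu : pM M u = 1 := by
      refine le_antisymm hu₁ (le_of_not_gt fun hlt => ?_)
      obtain ⟨s, hs, hs₁, c, hc, h⟩ := hM.exists_lt_of_pM_lt hu hlt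
      have h₁ := hdom hs hc h
      rw [abs_of_nonneg hu₀] at h₁
      have h₂ : (1 - s) • u ≤ (1 - s) • 0 := by
        rw [sub_smul, one_smul, smul_zero]
        exact sub_nonpos.2 h₁
      have h₃ : u ≤ 0 := le_of_smul_le_smul_left h₂ (sub_pos.2 hs₁)
      exact hm₀ne (le_antisymm ((hub m₀ hm₀).trans h₃) (hM.2.1 m₀ hm₀))
    refine ⟨u, hu₀, hu, ?_, fun v hv => ?_⟩
    · ext v
      constructor
      · intro hv
        obtain ⟨s, hs, c, hc, h⟩ := hM.mem_EMaj_iff.1 hv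
        exact ⟨s, hs, hdom hs hc h⟩
      · rintro ⟨t, ht, h⟩
        exact (hM.pM_le_mul hu hu₀ ht h).1
    · rw [hpu, div_one, one_mul]
      have hbelow : BddBelow {t : ℝ | 0 < t ∧ |v| ≤ t • u} := ⟨0, fun t ht => ht.1.le⟩
      have hlt : ∀ r, pM M v < r → r ∈ {t : ℝ | 0 < t ∧ |v| ≤ t • u} := fun r hr => by
        obtain ⟨s, hs, hsr, c, hc, h⟩ := hM.exists_lt_of_pM_lt hv hr
        exact ⟨hs.trans_lt hsr,
          (hdom hs hc h).trans (smul_le_smul_of_nonneg_right hsr.le hu₀)⟩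
      refine le_antisymm (le_csInf ⟨_, hlt _ (lt_add_one _)⟩ fun t ht => ?_)
        (le_of_forall_gt_imp_ge_of_dense fun r hr => csInf_le hbelow (hlt r hr))
      simpa [hpu] using (hM.pM_le_mul hu hu₀ ht.1.le ht.2).2
  · rintro ⟨u, hu₀, hu, hEM, hp⟩
    obtain ⟨C, hC⟩ := hbdd
    have hpu : 0 < pM M u := by
      refine (pM_nonneg u).lt_of_ne fun h => hm₀ne ?_
      have h₁ := hp m₀ (hM.subset_EMaj hm₀)
      rw [← h, div_zero, zero_mul] at h₁
      have h₂ := hM.norm_le_mul_pM hC (hM.subset_EMaj hm₀)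
      rw [h₁, mul_zero] at h₂
      exact norm_le_zero_iff.1 h₂
    have hne : ∀ v ∈ EMaj M, {t : ℝ | 0 < t ∧ |v| ≤ t • u}.Nonempty := fun v hv => by
      obtain ⟨t, ht, h⟩ : ∃ t : ℝ, 0 ≤ t ∧ |v| ≤ t • u := by
        rw [hEM] at hv; exact hv
      exact ⟨t + 1, by positivity,
        h.trans (smul_le_smul_of_nonneg_right (le_add_of_nonneg_right zero_le_one) hu₀)⟩
    have hlt : ∀ v ∈ EMaj M, ∀ r, pM M v < r → |v| ≤ (r * pM M u) • u := fun v hv r hr => by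
      rw [hp v hv, one_div, inv_mul_lt_iff₀ hpu, mul_comm] at hr
      obtain ⟨t, ht, htr⟩ := exists_lt_of_csInf_lt (hne v hv) hr
      exact ht.2.trans (smul_le_smul_of_nonneg_right htr.le hu₀)
    have hle : ∀ v, ∀ r, 0 ≤ r → |v| ≤ (r * pM M u) • u → v ∈ EMaj M ∧ pM M v ≤ r :=
        fun v r hr h => by
      have hv := (hM.pM_le_mul hu hu₀ (mul_nonneg hr hpu.le) h).1
      refine ⟨hv, le_of_forall_gt_imp_ge_of_dense fun r' hr' => ?_⟩
      rw [hp v hv, one_div, inv_mul_le_iff₀ hpu, mul_comm]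
      exact csInf_le ⟨0, fun t ht => ht.1.le⟩ ⟨mul_pos (hr.trans_lt hr') hpu,
        h.trans (smul_le_smul_of_nonneg_right (mul_le_mul_of_nonneg_right hr'.le hpu.le) hu₀)⟩
    refine ⟨fun x hx hcauchy => ?_, fun v hv w hw hv₀ hw₀ => le_antisymm ?_ ?_, u, hu, hu₀, ?_⟩
    · have hC₀ : 0 ≤ C := (norm_nonneg m₀).trans (hC m₀ hm₀)
      have hcs : CauchySeq x := Metric.cauchySeq_iff.2 fun ε hε => by
        obtain ⟨N, hN⟩ := hcauchy (ε / (C + 1)) (by positivity)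
        refine ⟨N, fun p hp q hq => ?_⟩
        rw [dist_eq_norm]
        have h₁ := hM.norm_le_mul_pM hC (hM.sub_mem_EMaj (hx p) (hx q))
        have h₂ := hN p hp q hq
        rw [lt_div_iff₀ (by positivity)] at h₂
        nlinarith [pM_nonneg (M := M) (x p - x q)]
      obtain ⟨l, hl⟩ := cauchySeq_tendsto_of_complete hcs
      have hbound : ∀ ε : ℝ, 0 < ε → ∃ N : ℕ, ∀ n ≥ N,
          x n - l ∈ EMaj M ∧ pM M (x n - l) ≤ ε := fun ε hε => by
        obtain ⟨N, hN⟩ := hcauchy ε hε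
        refine ⟨N, fun n hn => hle _ ε hε.le (abs_le'.2 ⟨?_, ?_⟩)⟩
        · refine le_of_tendsto (hl.const_sub (x n)) ?_
          filter_upwards [Filter.eventually_ge_atTop N] with q hq
          exact (le_abs_self _).trans
            (hlt _ (hM.sub_mem_EMaj (hx n) (hx q)) ε (hN n hn q hq))
        · refine le_of_tendsto (hl.const_sub (x n)).neg ?_
          filter_upwards [Filter.eventually_ge_atTop N] with q hq
          exact (neg_le_abs _).trans
            (hlt _ (hM.sub_mem_EMaj (hx n) (hx q)) ε (hN n hn q hq))
      refine ⟨l, ?_, fun ε hε => ?_⟩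
      · obtain ⟨N, hN⟩ := hbound 1 one_pos
        simpa using hM.sub_mem_EMaj (hx N) (hN N le_rfl).1
      · obtain ⟨N, hN⟩ := hbound (ε / 2) (half_pos hε)
        exact ⟨N, fun n hn => (hN n hn).2.trans_lt (half_lt_self hε)⟩
    · refine le_of_forall_gt_imp_ge_of_dense fun r hr => ?_
      obtain ⟨hvr, hwr⟩ := max_lt_iff.1 hr
      refine (hle _ r ((pM_nonneg v).trans hvr.le) ?_).2
      rw [abs_of_nonneg (hv₀.trans le_sup_left)]
      exact sup_le ((le_abs_self v).trans (hlt v hv r hvr))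
        ((le_abs_self w).trans (hlt w hw r hwr))
    · have hvw := hM.sup_mem_EMaj hv hw hv₀ hw₀
      have habs : |v ⊔ w| = v ⊔ w := abs_of_nonneg (hv₀.trans le_sup_left)
      exact max_le (hM.pM_mono hvw (by rw [habs, abs_of_nonneg hv₀]; exact le_sup_left))
        (hM.pM_mono hvw (by rw [habs, abs_of_nonneg hw₀]; exact le_sup_right))
    · intro v hv
      obtain ⟨t, ht, h⟩ := hne v hv
      exact ⟨t, ht, (le_abs_self v).trans h⟩
end

section
/- Let $E$ be a Banach lattice and $M$ a positive uniformly bounded subset of $E$. Then the closure of $C_M$ in $E_{\overline{M}}$ with respect to the $p_{\overline{M}}$-norm coincides with the closure of $C_{\overline{M}} = \overline{M}$ in $E_{\overline{M}}$ with respect to the $p_{\overline{M}}$-norm. -/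
open scoped BigOperators

section MbarDefs

variable {E : Type*} [NormedAddCommGroup E] [Lattice E] [HasSolidNorm E]
  [IsOrderedAddMonoid E] [NormedSpace ℝ E]

/-- The set `M̅` of all sums of norm-convergent series `∑ t_j • m_j` with summable nonnegative
coefficients `t_j` and terms `m_j ∈ M`. -/
def MbarSet (M : Set E) : Set E :=
  {w | ∃ (t : ℕ → ℝ) (m : ℕ → E), (∀ j, 0 ≤ t j) ∧ (∀ j, m j ∈ M) ∧
        Summable t ∧ HasSum (fun j => t j • m j) w}

/-- The space `E_{M̅}` of vectors majorized by `M̅`. -/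
def EMbar (M : Set E) : Set E := {v | ∃ w ∈ MbarSet M, |v| ≤ w}

/-- The norm `p_{M̅}`. -/
noncomputable def pMbar (M : Set E) (v : E) : ℝ :=
  sInf {s : ℝ | ∃ (t : ℕ → ℝ) (m : ℕ → E) (w : E), (∀ j, 0 ≤ t j) ∧ (∀ j, m j ∈ M) ∧
        Summable t ∧ HasSum (fun j => t j • m j) w ∧ |v| ≤ w ∧ s = ∑' j, t j}

end MbarDefs

section MbarCone

variable {E : Type*} [NormedAddCommGroup E] [NormedSpace ℝ E] {M : Set E}

/-- `w` is the sum of a series `∑ t_j • m_j` with terms in `M` and nonnegative coefficients of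
total mass `s`. -/
def HasSeriesOfMass (M : Set E) (s : ℝ) (w : E) : Prop :=
  ∃ (t : ℕ → ℝ) (m : ℕ → E), (∀ j, 0 ≤ t j) ∧ (∀ j, m j ∈ M) ∧
    HasSum t s ∧ HasSum (fun j => t j • m j) w

theorem HasSeriesOfMass.add {s₁ s₂ : ℝ} {w₁ w₂ : E} (h₁ : HasSeriesOfMass M s₁ w₁)
    (h₂ : HasSeriesOfMass M s₂ w₂) : HasSeriesOfMass M (s₁ + s₂) (w₁ + w₂) := by
  obtain ⟨t₁, m₁, ht₁, hm₁, hs₁, hw₁⟩ := h₁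
  obtain ⟨t₂, m₂, ht₂, hm₂, hs₂, hw₂⟩ := h₂
  let e : ℕ ≃ ℕ ⊕ ℕ := Equiv.natSumNatEquivNat.symm
  refine ⟨Sum.elim t₁ t₂ ∘ e, Sum.elim m₁ m₂ ∘ e, fun j => ?_, fun j => ?_, ?_, ?_⟩
  · rcases h : e j with k | k <;> simp [h, ht₁, ht₂]
  · rcases h : e j with k | k <;> simp [h, hm₁, hm₂]
  · exact e.hasSum_iff.mpr (HasSum.sum hs₁ hs₂)
  · exact (e.hasSum_iff (f := fun i => Sum.elim t₁ t₂ i • Sum.elim m₁ m₂ i)).mpr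
      (HasSum.sum hw₁ hw₂)

theorem HasSeriesOfMass.smul {s r : ℝ} {w : E} (hr : 0 ≤ r) (h : HasSeriesOfMass M s w) :
    HasSeriesOfMass M (r * s) (r • w) := by
  obtain ⟨t, m, ht, hm, hs, hw⟩ := h
  refine ⟨fun j => r * t j, m, fun j => mul_nonneg hr (ht j), hm, hs.mul_left r, ?_⟩
  simpa only [mul_smul] using hw.const_smul r

theorem hasSeriesOfMass_of_mem {x : E} (hx : x ∈ M) : HasSeriesOfMass M 1 x := by
  refine ⟨fun j => if j = 0 then 1 else 0, fun _ => x, fun j => by positivity, fun _ => hx,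
    hasSum_ite_eq 0 1, ?_⟩
  simpa only [ite_smul, one_smul, zero_smul] using hasSum_ite_eq (0 : ℕ) x

theorem mem_MbarSet_iff {w : E} : w ∈ MbarSet M ↔ ∃ s, HasSeriesOfMass M s w := by
  constructor
  · rintro ⟨t, m, ht, hm, hs, hw⟩
    exact ⟨_, t, m, ht, hm, hs.hasSum, hw⟩
  · rintro ⟨s, t, m, ht, hm, hs, hw⟩
    exact ⟨t, m, ht, hm, hs.summable, hw⟩

theorem convex_MbarSet : Convex ℝ (MbarSet M) := by
  intro x hx y hy a b ha hb _
  obtain ⟨s, hs⟩ := mem_MbarSet_iff.mp hx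
  obtain ⟨r, hr⟩ := mem_MbarSet_iff.mp hy
  exact mem_MbarSet_iff.mpr ⟨_, (hs.smul ha).add (hr.smul hb)⟩

theorem coneGen_subset_MbarSet : coneGen M ⊆ MbarSet M := by
  rintro _ ⟨t, x, ht, hx, -, rfl⟩
  have hxM : x ∈ MbarSet M :=
    convexHull_min (fun y hy => mem_MbarSet_iff.mpr ⟨1, hasSeriesOfMass_of_mem hy⟩)
      convex_MbarSet hx
  obtain ⟨s, hs⟩ := mem_MbarSet_iff.mp hxM
  exact mem_MbarSet_iff.mpr ⟨_, hs.smul ht⟩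

variable [Lattice E]

theorem pMbar_eq_sInf (v : E) :
    pMbar M v = sInf {s : ℝ | ∃ w, HasSeriesOfMass M s w ∧ |v| ≤ w} := by
  unfold pMbar
  congr 1
  ext s
  constructor
  · rintro ⟨t, m, w, ht, hm, hs, hw, hv, rfl⟩
    exact ⟨w, ⟨t, m, ht, hm, hs.hasSum, hw⟩, hv⟩
  · rintro ⟨w, ⟨t, m, ht, hm, hs, hw⟩, hv⟩
    exact ⟨t, m, w, ht, hm, hs.summable, hw, hv, hs.tsum_eq.symm⟩

theorem pMbar_le {s : ℝ} {v w : E} (h : HasSeriesOfMass M s w) (hv : |v| ≤ w) :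
    pMbar M v ≤ s := by
  rw [pMbar_eq_sInf]
  refine csInf_le ⟨0, ?_⟩ ⟨w, h, hv⟩
  rintro _ ⟨_, ⟨_, _, ht, _, hs, _⟩, _⟩
  exact hs.nonneg ht

theorem exists_hasSeriesOfMass_of_pMbar_lt {ε : ℝ} {v : E} (hv : v ∈ EMbar M)
    (h : pMbar M v < ε) : ∃ s < ε, ∃ w, HasSeriesOfMass M s w ∧ |v| ≤ w := by
  rw [pMbar_eq_sInf] at h
  obtain ⟨w, hw, hvw⟩ := hv
  obtain ⟨s, hs⟩ := mem_MbarSet_iff.mp hw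
  have hne : {s : ℝ | ∃ w, HasSeriesOfMass M s w ∧ |v| ≤ w}.Nonempty := ⟨s, w, hs, hvw⟩
  obtain ⟨r, hr, hrε⟩ := exists_lt_of_csInf_lt hne h
  exact ⟨r, hrε, hr⟩

theorem sum_smul_mem_coneGen (hM : IsPositiveSubset M) {ι : Type*} (u : Finset ι) {t : ι → ℝ}
    {m : ι → E} (ht : ∀ j ∈ u, 0 ≤ t j) (hm : ∀ j ∈ u, m j ∈ M) :
    ∑ j ∈ u, t j • m j ∈ coneGen M := by
  obtain ⟨⟨x, hx⟩, -, h0⟩ := hM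
  rcases (Finset.sum_nonneg ht).eq_or_lt with h | h
  · have hz := (Finset.sum_eq_zero_iff_of_nonneg ht).mp h.symm
    have hxM := subset_convexHull ℝ M hx
    refine ⟨0, x, le_rfl, hxM, ne_of_mem_of_not_mem hxM h0, ?_⟩
    rw [zero_smul]
    exact Finset.sum_eq_zero fun j hj => by rw [hz j hj, zero_smul]
  · have hc := u.centerMass_mem_convexHull ht h hm
    refine ⟨∑ j ∈ u, t j, u.centerMass t m, h.le, hc, ne_of_mem_of_not_mem hc h0, ?_⟩
    rw [Finset.centerMass, smul_inv_smul₀ (ne_of_gt h)]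

/-- Truncating a series far enough leaves a tail of arbitrarily small mass. -/
theorem exists_mem_coneGen_hasSeriesOfMass_sub (hM : IsPositiveSubset M) {c : E}
    (hc : c ∈ MbarSet M) {ε : ℝ} (hε : 0 < ε) :
    ∃ d ∈ coneGen M, ∃ s < ε, HasSeriesOfMass M s (c - d) := by
  obtain ⟨t, m, ht, hm, hs, hw⟩ := hc
  obtain ⟨N, hN⟩ := ((tendsto_order.mp (tendsto_sum_nat_add t)).2 ε hε).exists
  refine ⟨_, sum_smul_mem_coneGen hM (Finset.range N) (fun j _ => ht j) (fun j _ => hm j),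
    _, hN, fun j => t (j + N), fun j => m (j + N), fun j => ht _, fun j => hm _,
    ((summable_nat_add_iff N).mpr hs).hasSum, (hasSum_nat_add_iff' N).mpr hw⟩

theorem MbarSet_nonneg [HasSolidNorm E] [IsOrderedAddMonoid E] [IsStrictOrderedModule ℝ E]
    (hM : IsPositiveSubset M) {w : E} (hw : w ∈ MbarSet M) : 0 ≤ w := by
  obtain ⟨t, m, ht, hm, -, hw⟩ := hw
  exact hw.nonneg fun j => smul_nonneg (ht j) (hM.2.1 _ (hm j))

theorem sub_mem_EMbar [HasSolidNorm E] [IsOrderedAddMonoid E] [IsStrictOrderedModule ℝ E]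
    (hM : IsPositiveSubset M) {v c : E} (hv : v ∈ EMbar M) (hc : c ∈ MbarSet M) :
    v - c ∈ EMbar M := by
  obtain ⟨w, hw, hvw⟩ := hv
  have hc₀ := MbarSet_nonneg hM hc
  obtain ⟨s, hs⟩ := mem_MbarSet_iff.mp hw
  obtain ⟨r, hr⟩ := mem_MbarSet_iff.mp hc
  refine ⟨w + c, mem_MbarSet_iff.mpr ⟨_, hs.add hr⟩, ?_⟩
  calc |v - c| ≤ |v| + |c| := by simpa [sub_eq_add_neg] using abs_add_le v (-c)
    _ ≤ w + c := by rw [abs_of_nonneg hc₀]; gcongr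

end MbarCone

/-- Let `E` be a Banach lattice and `M` a positive uniformly bounded subset.
Then the closure of `C_M` in `E_{M̅}` for the `p_{M̅}`-norm coincides with the closure of
`C_{M̅} = M̅` in `E_{M̅}` for the `p_{M̅}`-norm. -/
theorem closure_coneGen_eq_closure_Mbar
    {E : Type*} [NormedAddCommGroup E] [Lattice E] [HasSolidNorm E]
      [IsOrderedAddMonoid E] [NormedSpace ℝ E] [IsStrictOrderedModule ℝ E]
    [CompleteSpace E]
    (M : Set E) (hM : IsPositiveSubset M)
    (hbdd : ∃ C : ℝ, ∀ m ∈ M, ‖m‖ ≤ C) :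
    {v | v ∈ EMbar M ∧ ∀ ε : ℝ, 0 < ε → ∃ c ∈ coneGen M, pMbar M (v - c) < ε} =
    {v | v ∈ EMbar M ∧ ∀ ε : ℝ, 0 < ε → ∃ c ∈ MbarSet M, pMbar M (v - c) < ε} := by
  ext v
  refine and_congr_right fun hv => forall₂_congr fun ε hε => ⟨?_, ?_⟩
  · rintro ⟨c, hc, hlt⟩
    exact ⟨c, coneGen_subset_MbarSet hc, hlt⟩
  · rintro ⟨c, hc, hlt⟩
    obtain ⟨s, hs, w, hw, hvw⟩ :=
      exists_hasSeriesOfMass_of_pMbar_lt (sub_mem_EMbar hM hv hc) hlt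
    obtain ⟨d, hd, r, hr, hcd⟩ := exists_mem_coneGen_hasSeriesOfMass_sub hM hc (sub_pos.mpr hs)
    have hcd₀ : 0 ≤ c - d := MbarSet_nonneg hM (mem_MbarSet_iff.mpr ⟨r, hcd⟩)
    refine ⟨d, hd, (pMbar_le (hw.add hcd) ?_).trans_lt (by linarith)⟩
    calc |v - d| = |(v - c) + (c - d)| := by rw [sub_add_sub_cancel]
      _ ≤ |v - c| + |c - d| := abs_add_le _ _
      _ ≤ w + (c - d) := by rw [abs_of_nonneg hcd₀]; gcongr
end
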